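/- Let λ > 0, V(x,y) = x⁴/4! + λ x²y²/4 + λ² y⁴/4!, and g(x,y) = −x²/2 − y²/2 + V(x,y). The non-zero complex critical points of g, i.e. solutions (w,z) ≠ (0,0) of w = ∂V/∂w(w,z) and z = ∂V/∂z(w,z), are exactly (±√6, 0), (0, ±√6/λ), and (±√((9−3λ)/(4λ)), ±√(9λ−3)/(2λ)); the last family of four points is real if and only if 1/3 ≤ λ ≤ 3. -/

import Mathlib

theorem im_zero_iff_aux (a : ℂ) (r : ℝ) (h : a ^ 2 = (r : ℂ)) : a.im = 0 ↔ 0 ≤ r := by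
  have h1 := congrArg Complex.re h
  have h2 := congrArg Complex.im h
  simp only [pow_two, Complex.mul_re, Complex.mul_im, Complex.ofReal_re, Complex.ofReal_im] at h1 h2
  constructor
  · intro h0
    rw [h0] at h1
    nlinarith [mul_self_nonneg a.re]
  · intro hr
    have h3 : a.re * a.im = 0 := by linarith
    rcases mul_eq_zero.mp h3 with h4 | h4
    · rw [h4] at h1
      have : a.im * a.im = 0 := by nlinarith [mul_self_nonneg a.im]
      exact mul_self_eq_zero.mp this
    · exact h4

/-- Non-zero complex critical points of `g(x,y) = -x²/2 - y²/2 + V(x,y)` for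
`V(x,y) = x⁴/4! + λ x²y²/4 + λ² y⁴/4!` with `λ > 0`: they are exactly
`(±√6, 0)`, `(0, ±√6/λ)` and `(±α, ±β/(2λ))` where `α² = (9-3λ)/(4λ)` and
`β² = 9λ-3`; the mixed family is real iff `1/3 ≤ λ ≤ 3`. -/
theorem complex_crit_points (lam : ℝ) (hpos : 0 < lam) :
    ∃ α β : ℂ,
      α ^ 2 = (((9 - 3 * lam) / (4 * lam) : ℝ) : ℂ) ∧
      β ^ 2 = ((9 * lam - 3 : ℝ) : ℂ) ∧
      ({p : ℂ × ℂ | p ≠ 0 ∧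
          p.1 = p.1 ^ 3 / 6 + (lam : ℂ) * p.1 * p.2 ^ 2 / 2 ∧
          p.2 = (lam : ℂ) * p.1 ^ 2 * p.2 / 2 + (lam : ℂ) ^ 2 * p.2 ^ 3 / 6} =
        {(((Real.sqrt 6 : ℝ) : ℂ), (0:ℂ)), (-((Real.sqrt 6 : ℝ) : ℂ), (0:ℂ)),
         ((0:ℂ), ((Real.sqrt 6 / lam : ℝ) : ℂ)), ((0:ℂ), -((Real.sqrt 6 / lam : ℝ) : ℂ)),
         (α, β / (2 * lam)), (α, -(β / (2 * lam))),
         (-α, β / (2 * lam)), (-α, -(β / (2 * lam)))}) ∧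
      ((α.im = 0 ∧ (β / (2 * (lam : ℂ))).im = 0) ↔ (1 / 3 ≤ lam ∧ lam ≤ 3)) := by
  obtain ⟨α, hα⟩ := IsAlgClosed.exists_pow_nat_eq
    (((9 - 3 * lam) / (4 * lam) : ℝ) : ℂ) (n := 2) (by norm_num)
  obtain ⟨β, hβ⟩ := IsAlgClosed.exists_pow_nat_eq ((9 * lam - 3 : ℝ) : ℂ) (n := 2) (by norm_num)
  refine ⟨α, β, hα, hβ, ?_, ?_⟩
  · have hl : (lam : ℂ) ≠ 0 := by exact_mod_cast hpos.ne'
    obtain ⟨s, hs⟩ : ∃ s : ℂ, s = ((Real.sqrt 6 : ℝ) : ℂ) := ⟨_, rfl⟩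
    have hs2 : s ^ 2 = 6 := by
      rw [hs]
      have : Real.sqrt 6 ^ 2 = 6 := Real.sq_sqrt (by norm_num)
      exact_mod_cast this
    have hs0 : s ≠ 0 := by
      rintro rfl
      norm_num at hs2
    push_cast at hα hβ ⊢
    rw [← hs]
    obtain ⟨l, hll⟩ : ∃ l : ℂ, l = (lam : ℂ) := ⟨_, rfl⟩
    rw [← hll] at hα hβ hl ⊢
    clear hs hll
    obtain ⟨γ, hγ⟩ : ∃ γ : ℂ, γ = β / (2 * l) := ⟨_, rfl⟩
    rw [← hγ]
    have hα' : 4 * l * α ^ 2 = 9 - 3 * l := by rw [hα]; field_simp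
    have hγ' : 4 * l ^ 2 * γ ^ 2 = 9 * l - 3 := by rw [← hβ, hγ]; field_simp; ring
    obtain ⟨t, ht⟩ : ∃ t : ℂ, t = s / l := ⟨_, rfl⟩
    rw [← ht]
    have ht' : l ^ 2 * t ^ 2 = 6 := by rw [← hs2, ht]; field_simp
    have ht0 : t ≠ 0 := by
      rintro rfl
      norm_num at ht'
    have e1 : α ^ 2 / 6 + l * γ ^ 2 / 2 = 1 := by
      apply mul_left_cancel₀ hl
      linear_combination hα' / 24 + hγ' / 8
    have e2 : l * α ^ 2 / 2 + l ^ 2 * γ ^ 2 / 6 = 1 := by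
      linear_combination hα' / 8 + hγ' / 24
    have hne : ¬ (α = 0 ∧ γ = 0) := by
      rintro ⟨rfl, rfl⟩
      norm_num at e1
    have key : ∀ w z : ℂ, w ^ 2 = α ^ 2 → z ^ 2 = γ ^ 2 → ((w, z) : ℂ × ℂ) ≠ 0 ∧
        w = w ^ 3 / 6 + l * w * z ^ 2 / 2 ∧ z = l * w ^ 2 * z / 2 + l ^ 2 * z ^ 3 / 6 := by
      intro w z hw hz
      rw [← hw, ← hz] at e1 e2
      refine ⟨?_, ?_, ?_⟩
      · intro h
        obtain ⟨rfl, rfl⟩ := Prod.mk.inj h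
        norm_num at e1
      · linear_combination -w * e1
      · linear_combination -z * e2
    ext ⟨w, z⟩
    simp only [Set.mem_ofPred_eq, Set.mem_insert_iff, Set.mem_singleton_iff, Prod.mk.injEq]
    constructor
    · rintro ⟨hn, h1, h2⟩
      by_cases hz : z = 0
      · subst hz
        have hw : w ≠ 0 := by
          rintro rfl
          exact hn rfl
        have : w ^ 2 = s ^ 2 := by
          apply mul_left_cancel₀ hw
          linear_combination -6 * h1 - w * hs2
        rcases sq_eq_sq_iff_eq_or_eq_neg.mp this with h | h <;> simp [h]
      · by_cases hw : w = 0
        · subst hw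
          have : z ^ 2 = t ^ 2 := by
            apply mul_left_cancel₀ hz
            apply mul_left_cancel₀ (pow_ne_zero 2 hl)
            linear_combination -6 * h2 - z * ht'
          rcases sq_eq_sq_iff_eq_or_eq_neg.mp this with h | h <;> simp [h]
        · have f1 : w ^ 2 / 6 + l * z ^ 2 / 2 = 1 := by
            apply mul_left_cancel₀ hw
            linear_combination -h1
          have f2 : l * w ^ 2 / 2 + l ^ 2 * z ^ 2 / 6 = 1 := by
            apply mul_left_cancel₀ hz
            linear_combination -h2
          have a1 : w ^ 2 = α ^ 2 := by
            apply mul_left_cancel₀ hl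
            linear_combination 9 / 4 * (f2 - e2) - 3 / 4 * l * (f1 - e1)
          have a2 : z ^ 2 = γ ^ 2 := by
            apply mul_left_cancel₀ hl
            linear_combination 2 * (f1 - e1) - a1 / 3
          rcases sq_eq_sq_iff_eq_or_eq_neg.mp a1 with h | h <;>
            rcases sq_eq_sq_iff_eq_or_eq_neg.mp a2 with h' | h' <;> simp [h, h']
    · rintro (⟨rfl, rfl⟩ | ⟨rfl, rfl⟩ | ⟨rfl, rfl⟩ | ⟨rfl, rfl⟩ | ⟨rfl, rfl⟩ | ⟨rfl, rfl⟩ |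
        ⟨rfl, rfl⟩ | ⟨rfl, rfl⟩)
      · exact ⟨fun h => hs0 (Prod.mk.inj h).1, by linear_combination -w / 6 * hs2, by ring⟩
      · exact ⟨fun h => hs0 (neg_eq_zero.mp (Prod.mk.inj h).1),
          by linear_combination s / 6 * hs2, by ring⟩
      · exact ⟨fun h => ht0 (Prod.mk.inj h).2, by ring, by linear_combination -z / 6 * ht'⟩
      · exact ⟨fun h => ht0 (neg_eq_zero.mp (Prod.mk.inj h).2), by ring,
          by linear_combination t / 6 * ht'⟩
      all_goals exact key _ _ (by ring) (by ring)
  · have hg : (β / (2 * (lam : ℂ))).im = 0 ↔ β.im = 0 := by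
      have : β / (2 * (lam : ℂ)) = β / ((2 * lam : ℝ) : ℂ) := by push_cast; rfl
      rw [this, Complex.div_ofReal_im, div_eq_zero_iff]
      constructor
      · rintro (h | h)
        · exact h
        · linarith
      · exact Or.inl
    rw [hg, im_zero_iff_aux α _ hα, im_zero_iff_aux β _ hβ, le_div_iff₀ (by linarith)]
    constructor
    · rintro ⟨h1, h2⟩
      constructor <;> linarith
    · rintro ⟨h1, h2⟩
      constructor <;> linarith
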